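/- (Orthogonality–Discrepancy Lemma, discrepancy bound.) Let k ≥ 2, m ≥ 1, d > 2 be integers, let μ be a probability distribution on {0,1}^m, and let f : {0,1}^m → {−1,1} be (μ,d)-orthogonal. Let ℓ be an integer with ℓ − 1 ≥ 2^{2^k}(k−1)e·m/d (e being Euler's number), let n = ℓ^{k−1}m, and let λ be the probability distribution on {0,1}^n × ([ℓ]^m)^{k−1} given by λ(x, S^1,…,S^{k−1}) = μ(x ← S^1,…,S^{k−1})/(ℓ^{m(k−1)} 2^{n−m}). Then disc_{k,λ}(F^f_k) ≤ 2^{−d/2^{k−1}}. -/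

import Mathlib

open scoped BigOperators

/-- `x ← S^1,…,S^{K}`: with `x ∈ {0,1}^n` (`n = ℓ^K·m`) viewed as `m` blocks, each a
`K`-dimensional array of side `ℓ`, the `α`-th bit of the result is
`x[α][S^1[α],…,S^K[α]]`. -/
def mask {K ℓ m : ℕ} (x : Fin m → (Fin K → Fin ℓ) → Bool)
    (S : Fin K → Fin m → Fin ℓ) : Fin m → Bool :=
  fun α => x α (fun i => S i α)

/-- The masked function `F^f_k (x, S^1,…,S^{k-1}) = f(x ← S^1,…,S^{k-1})`. -/
def Ffun {K ℓ m : ℕ} (f : (Fin m → Bool) → ℝ)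
    (p : (Fin m → (Fin K → Fin ℓ) → Bool) × (Fin K → Fin m → Fin ℓ)) : ℝ :=
  f (mask p.1 p.2)

/-- A probability distribution on a finite set. -/
def IsProbDist {D : Type*} [Fintype D] (μ : D → ℝ) : Prop :=
  (∀ x, 0 ≤ μ x) ∧ ∑ x, μ x = 1

/-- The distribution `λ(x,S^1,…,S^{k-1}) = μ(x ← S^1,…,S^{k-1}) / (ℓ^{m(k-1)} 2^{n-m})`. -/
noncomputable def lamDist (k ℓ m n : ℕ) (μ : (Fin m → Bool) → ℝ)
    (p : (Fin m → (Fin (k - 1) → Fin ℓ) → Bool) × (Fin (k - 1) → Fin m → Fin ℓ)) : ℝ :=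
  μ (mask p.1 p.2) / ((ℓ : ℝ) ^ (m * (k - 1)) * 2 ^ (n - m))

/-- A cylinder intersection on the `k`-party domain `{0,1}^n × ([ℓ]^m)^{k-1}`
(one player holds `x`, and one player holds each `S^i`): a conjunction of a cylinder
not depending on `x` and, for each `i`, a cylinder not depending on `S^i`. -/
def IsCylinderIntersection {X V : Type*} {K : ℕ}
    (φ : X × (Fin K → V) → Bool) : Prop :=
  ∃ (ψ₀ : X × (Fin K → V) → Bool) (ψ : Fin K → X × (Fin K → V) → Bool),
    (∀ x x' S, ψ₀ (x, S) = ψ₀ (x', S)) ∧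
    (∀ i x S S', (∀ j, j ≠ i → S j = S' j) → ψ i (x, S) = ψ i (x, S')) ∧
    (∀ p, φ p = (ψ₀ p && decide (∀ i, ψ i p = true)))

/-- Interpret a boolean as the real `0` or `1`. -/
noncomputable def bval (b : Bool) : ℝ := if b then 1 else 0

/-- `disc^φ_{k,λ}(F) = |E_{y∼λ}[F(y)φ(y)]|`. -/
noncomputable def discPhi {D : Type*} [Fintype D] (lam : D → ℝ) (F : D → ℝ)
    (φ : D → Bool) : ℝ :=
  |∑ y, lam y * F y * bval (φ y)|

/-- `disc_{k,λ}(F)`: the supremum of `disc^φ_{k,λ}(F)` over cylinder intersections `φ`. -/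
noncomputable def disc {X V : Type*} [Fintype X] [Fintype V] {K : ℕ}
    (lam : X × (Fin K → V) → ℝ) (F : X × (Fin K → V) → ℝ) : ℝ :=
  sSup { t | ∃ φ, IsCylinderIntersection φ ∧ t = discPhi lam F φ }

/-- The character `χ_S(x) = (-1)^{Σ_{i∈S} x_i}`. -/
noncomputable def chiChar {m : ℕ} (S : Finset (Fin m)) (z : Fin m → Bool) : ℝ :=
  ∏ i ∈ S, (if z i then (-1 : ℝ) else 1)

/-- `f` is `(μ,d)`-orthogonal: `E_{x∼μ}[f(x)χ_S(x)] = 0` for every `S` with `|S| < d`. -/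
def Orthogonal {m : ℕ} (μ : (Fin m → Bool) → ℝ) (d : ℕ) (f : (Fin m → Bool) → ℝ) : Prop :=
  ∀ S : Finset (Fin m), S.card < d → ∑ z, μ z * f z * chiChar S z = 0

section helpers
open Finset
open scoped BigOperators

lemma jensen_expect {ι : Type*} [Fintype ι] [Nonempty ι] (f : ι → ℝ) (n : ℕ) :
    |𝔼 i, f i| ^ n ≤ 𝔼 i, |f i| ^ n := by
  have h1 : |𝔼 i, f i| ^ n ≤ (𝔼 i, |f i|) ^ n :=
    pow_le_pow_left₀ (abs_nonneg _) (Finset.abs_expect_le _ _) n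
  refine h1.trans ?_
  have h := Real.pow_arith_mean_le_arith_mean_pow (Finset.univ : Finset ι)
    (fun _ => (Fintype.card ι : ℝ)⁻¹) (fun i => |f i|) (fun _ _ => by positivity)
    (by simp) (fun _ _ => abs_nonneg _) n
  simpa [Fintype.expect_eq_sum_div_card, ← Finset.mul_sum, div_eq_inv_mul] using h

lemma cs_expect {ι : Type*} [Fintype ι] [Nonempty ι] (b h : ι → ℝ) (hb : ∀ i, |b i| ≤ 1) :
    |𝔼 i, b i * h i| ^ 2 ≤ 𝔼 i, h i ^ 2 := by
  refine (jensen_expect _ 2).trans (Finset.expect_le_expect fun i _ => ?_)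
  rw [sq_abs, mul_pow]
  have : b i ^ 2 ≤ 1 := (sq_le_one_iff_abs_le_one _).2 (hb i)
  nlinarith [sq_nonneg (h i)]

lemma expect_prod_type {ι κ : Type*} [Fintype ι] [Fintype κ] (f : ι × κ → ℝ) :
    𝔼 p, f p = 𝔼 i, 𝔼 j, f (i, j) := by
  rw [← Finset.univ_product_univ, Finset.expect_product]

lemma expect_cons {K : ℕ} {V : Type*} [Fintype V] (f : (Fin (K + 1) → V) → ℝ) :
    𝔼 S, f S = 𝔼 s : V, 𝔼 S : Fin K → V, f (Fin.cons s S) := by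
  rw [← expect_prod_type (fun p : V × (Fin K → V) => f (Fin.cons p.1 p.2))]
  symm
  exact Fintype.expect_equiv (Fin.consEquiv (fun _ => V)) _ _ (fun _ => rfl)

lemma prod_bool_cons {K : ℕ} (f : (Fin (K + 1) → Bool) → ℝ) :
    ∏ u, f u = ∏ u : Fin K → Bool, f (Fin.cons false u) * f (Fin.cons true u) := by
  have h : ∏ p : Bool × (Fin K → Bool), f (Fin.cons p.1 p.2) = ∏ u, f u :=
    Fintype.prod_equiv (Fin.consEquiv (fun _ => Bool)) _ _ (fun _ => rfl)
  rw [← h, Fintype.prod_prod_type, Fintype.prod_bool, ← Finset.prod_mul_distrib]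
  exact Finset.prod_congr rfl fun u _ => mul_comm _ _

lemma sel_cons {K : ℕ} {V : Type*} (c : Bool) (u : Fin K → Bool) (s t : V) (S T : Fin K → V) :
    (fun i => if (Fin.cons c u : Fin (K+1) → Bool) i then (Fin.cons t T : Fin (K+1) → V) i
      else (Fin.cons s S : Fin (K+1) → V) i) =
    (Fin.cons (if c then t else s) (fun i => if u i then T i else S i) : Fin (K+1) → V) := by
  funext i
  refine Fin.cases ?_ (fun j => ?_) i <;> simp

lemma cs_main {X V : Type*} [Fintype X] [Nonempty X] [Fintype V] [Nonempty V] (K : ℕ) :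
    ∀ (G : X → (Fin K → V) → ℝ) (ψ₀ : (Fin K → V) → ℝ) (ψ : Fin K → X → (Fin K → V) → ℝ),
    (∀ S, |ψ₀ S| ≤ 1) → (∀ i x S, |ψ i x S| ≤ 1) →
    (∀ i x S S', (∀ j, j ≠ i → S j = S' j) → ψ i x S = ψ i x S') →
    |𝔼 S, ψ₀ S * 𝔼 x, G x S * ∏ i, ψ i x S| ^ (2 ^ K) ≤
      𝔼 S : Fin K → V, 𝔼 T : Fin K → V, |𝔼 x, ∏ u : Fin K → Bool,
        G x (fun i => if u i then T i else S i)| := by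
  induction K with
  | zero =>
    intro G ψ₀ ψ h0 _ _
    simp only [pow_zero, pow_one]
    have e : ∀ (g : (Fin 0 → V) → ℝ), 𝔼 S, g S = g default := by
      intro g; simp
    have e2 : ∀ (g : (Fin 0 → Bool) → ℝ), ∏ S, g S = g default := by
      intro g; exact Fintype.prod_subsingleton _ default
    rw [e, e, e, abs_mul]
    simp only [e2, Finset.univ_eq_empty, Finset.prod_empty, mul_one]
    have e3 : ∀ x : X, G x (fun i => if (default : Fin 0 → Bool) i then (default : Fin 0 → V) i else
      (default : Fin 0 → V) i) = G x default := fun x => by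
      congr 1
    simp only [e3]
    exact mul_le_of_le_one_left (abs_nonneg _) (h0 _)
  | succ K ih =>
    intro G ψ₀ ψ h0 h1 h2
    obtain ⟨v0⟩ := ‹Nonempty V›
    have : Nonempty V := ⟨v0⟩
    set h : (Fin K → V) × X → V → ℝ := fun p s =>
      ψ₀ (Fin.cons s p.1) * (G p.2 (Fin.cons s p.1) *
        ∏ i : Fin K, ψ i.succ p.2 (Fin.cons s p.1)) with hh
    have key1 : 𝔼 S, ψ₀ S * 𝔼 x, G x S * ∏ i, ψ i x S =
        𝔼 p : (Fin K → V) × X, ψ 0 p.2 (Fin.cons v0 p.1) * 𝔼 s, h p s := by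
      rw [expect_cons, Finset.expect_comm, expect_prod_type]
      refine Finset.expect_congr rfl fun S _ => ?_
      simp_rw [Finset.mul_expect]
      rw [Finset.expect_comm]
      refine Finset.expect_congr rfl fun x _ => Finset.expect_congr rfl fun s _ => ?_
      rw [Fin.prod_univ_succ, h2 0 x (Fin.cons s S) (Fin.cons v0 S)]
      · simp only [hh]; ring
      · intro j hj
        obtain ⟨j, rfl⟩ := Fin.exists_succ_eq.2 hj
        simp
    set Q : V → V → ℝ := fun s t =>
      𝔼 S : Fin K → V, (ψ₀ (Fin.cons s S) * ψ₀ (Fin.cons t S)) *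
        𝔼 x, (G x (Fin.cons s S) * G x (Fin.cons t S)) *
          ∏ i : Fin K, (ψ i.succ x (Fin.cons s S) * ψ i.succ x (Fin.cons t S)) with hQ
    have key2 : 𝔼 p, (𝔼 s, h p s) ^ 2 = 𝔼 s, 𝔼 t, Q s t := by
      simp_rw [sq, Fintype.expect_mul_expect]
      rw [Finset.expect_comm]
      refine Finset.expect_congr rfl fun s _ => ?_
      rw [Finset.expect_comm]
      refine Finset.expect_congr rfl fun t _ => ?_
      rw [expect_prod_type]
      refine Finset.expect_congr rfl fun S _ => ?_
      rw [Finset.mul_expect]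
      refine Finset.expect_congr rfl fun x _ => ?_
      rw [Finset.prod_mul_distrib]
      simp only [hh]; ring
    have key3 : |𝔼 S, ψ₀ S * 𝔼 x, G x S * ∏ i, ψ i x S| ^ 2 ≤ |𝔼 s, 𝔼 t, Q s t| := by
      rw [key1, ← key2]
      exact (cs_expect _ _ (fun p => h1 _ _ _)).trans (le_abs_self _)
    rw [pow_succ', pow_mul]
    refine (pow_le_pow_left₀ (by positivity) key3 _).trans ?_
    refine (jensen_expect _ _).trans ?_
    refine (Finset.expect_le_expect (g := fun s => 𝔼 t, |Q s t| ^ (2 ^ K))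
      fun s _ => jensen_expect _ _).trans ?_
    rw [expect_cons]
    refine Finset.expect_le_expect fun s _ => ?_
    simp_rw [expect_cons (K := K)]
    rw [Finset.expect_comm]
    refine Finset.expect_le_expect fun t _ => ?_
    refine (ih (fun x S => G x (Fin.cons s S) * G x (Fin.cons t S))
      (fun S => ψ₀ (Fin.cons s S) * ψ₀ (Fin.cons t S))
      (fun i x S => ψ i.succ x (Fin.cons s S) * ψ i.succ x (Fin.cons t S)) ?_ ?_ ?_).trans ?_
    · intro S; rw [abs_mul]; exact mul_le_one₀ (h0 _) (abs_nonneg _) (h0 _)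
    · intro i x S; rw [abs_mul]; exact mul_le_one₀ (h1 _ _ _) (abs_nonneg _) (h1 _ _ _)
    · intro i x S S' hS
      have : ∀ r : V, ψ i.succ x (Fin.cons r S) = ψ i.succ x (Fin.cons r S') := by
        intro r
        apply h2
        intro j
        refine Fin.cases (by simp) (fun j hj => ?_) j
        simpa using hS j (fun hh => hj (by rw [hh]))
      simp only [this]
    · refine Finset.expect_le_expect fun S _ => Finset.expect_le_expect fun T _ => le_of_eq ?_
      congr 1
      refine Finset.expect_congr rfl fun x _ => ?_
      rw [prod_bool_cons]
      refine Finset.prod_congr rfl fun u _ => ?_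
      rw [sel_cons, sel_cons]
      simp

noncomputable def sgnB (b : Bool) : ℝ := if b then -1 else 1

def shiftB {m : ℕ} (A : Finset (Fin m)) (z w : Fin m → Bool) : Fin m → Bool :=
  fun α => if α ∈ A then z α else xor (z α) (w α)

lemma sum_shiftB {m : ℕ} (A : Finset (Fin m)) (z : Fin m → Bool) (h : (Fin m → Bool) → ℝ) :
    ∑ w, h (shiftB A z w) = ∑ y, h y * ∏ α ∈ A, (1 + sgnB (y α) * sgnB (z α)) := by
  have e1 : ∀ w, h (shiftB A z w) =
      ∑ y, h y * ∏ α, (if y α = shiftB A z w α then (1 : ℝ) else 0) := by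
    intro w
    rw [Finset.sum_eq_single (shiftB A z w)]
    · simp
    · intro y _ hy
      obtain ⟨α, hα⟩ := Function.ne_iff.1 hy
      rw [Finset.prod_eq_zero (Finset.mem_univ α) (by simp [hα]), mul_zero]
    · simp
  simp_rw [e1]
  rw [Finset.sum_comm]
  refine Finset.sum_congr rfl fun y _ => ?_
  rw [← Finset.mul_sum]
  congr 1
  have e2 := Fintype.prod_sum (fun (α : Fin m) (b : Bool) =>
    (if y α = (if α ∈ A then z α else xor (z α) b) then (1 : ℝ) else 0))
  refine Eq.trans e2.symm ?_
  rw [← Finset.prod_subset (Finset.subset_univ A)]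
  · refine Finset.prod_congr rfl fun α hα => ?_
    simp only [hα, if_true, sgnB, Fintype.sum_bool]
    cases y α <;> cases z α <;> norm_num
  · intro α _ hα
    simp only [hα, if_false, Fintype.sum_bool]
    cases y α <;> cases z α <;> norm_num

lemma chiChar_eq {m : ℕ} (S : Finset (Fin m)) (z : Fin m → Bool) :
    chiChar S z = ∏ i ∈ S, sgnB (z i) := rfl

lemma sum_shiftB_zero {m d : ℕ} (μ f : (Fin m → Bool) → ℝ) (horth : Orthogonal μ d f)
    (A : Finset (Fin m)) (hA : A.card < d) (z : Fin m → Bool) :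
    ∑ w, (fun y => μ y * f y) (shiftB A z w) = 0 := by
  rw [sum_shiftB A z (fun y => μ y * f y)]
  simp_rw [Finset.prod_one_add, Finset.mul_sum]
  rw [Finset.sum_comm]
  refine Finset.sum_eq_zero fun B hB => ?_
  have hc : B.card < d := (Finset.card_le_card (Finset.mem_powerset.1 hB)).trans_lt hA
  have := horth B hc
  simp_rw [Finset.prod_mul_distrib, ← chiChar_eq, ← mul_assoc]
  rw [← Finset.sum_mul, this, zero_mul]

lemma sum_shiftB_le {m : ℕ} (μ f : (Fin m → Bool) → ℝ) (hμ : IsProbDist μ)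
    (hf : ∀ z, f z = 1 ∨ f z = -1) (A : Finset (Fin m)) (z : Fin m → Bool) :
    |∑ w, (fun y => μ y * f y) (shiftB A z w)| ≤ 2 ^ A.card := by
  rw [sum_shiftB A z (fun y => μ y * f y)]
  have hs : ∀ a b, 0 ≤ 1 + sgnB a * sgnB b ∧ 1 + sgnB a * sgnB b ≤ 2 := by
    intro a b
    cases a <;> cases b <;> norm_num [sgnB]
  calc _ ≤ ∑ y, |(μ y * f y) * ∏ α ∈ A, (1 + sgnB (y α) * sgnB (z α))| :=
        Finset.abs_sum_le_sum_abs _ _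
    _ ≤ ∑ y, μ y * 2 ^ A.card := by
        refine Finset.sum_le_sum fun y _ => ?_
        have hfy : |f y| = 1 := by rcases hf y with h | h <;> simp [h]
        rw [abs_mul, abs_mul, hfy, mul_one, abs_of_nonneg (hμ.1 y),
          abs_of_nonneg (Finset.prod_nonneg fun α _ => (hs _ _).1)]
        refine mul_le_mul_of_nonneg_left ?_ (hμ.1 y)
        calc _ ≤ ∏ α ∈ A, (2 : ℝ) :=
              Finset.prod_le_prod (fun α _ => (hs _ _).1) (fun α _ => (hs _ _).2)
          _ = _ := by simp
    _ = 2 ^ A.card := by rw [← Finset.sum_mul, hμ.2, one_mul]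

def badSet {K ℓ m : ℕ} (S T : Fin K → Fin m → Fin ℓ) : Finset (Fin m) :=
  Finset.univ.filter fun α => ∃ i, S i α = T i α

open Classical in
noncomputable def flipX {K ℓ m : ℕ} (S T : Fin K → Fin m → Fin ℓ)
    (w : (Fin K → Bool) → Fin m → Bool) (x : Fin m → (Fin K → Fin ℓ) → Bool) :
    Fin m → (Fin K → Fin ℓ) → Bool :=
  fun α p => if α ∈ badSet S T then x α p else
    xor (x α p) (decide (∃ u : Fin K → Bool,
      p = (fun i => (if u i then T i else S i) α) ∧ w u α = true))

lemma flipX_invol {K ℓ m : ℕ} (S T : Fin K → Fin m → Fin ℓ)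
    (w : (Fin K → Bool) → Fin m → Bool) : Function.Involutive (flipX S T w) := by
  intro x
  funext α p
  simp only [flipX]
  split_ifs <;> simp

lemma mask_flipX {K ℓ m : ℕ} (S T : Fin K → Fin m → Fin ℓ)
    (w : (Fin K → Bool) → Fin m → Bool) (x : Fin m → (Fin K → Fin ℓ) → Bool)
    (u : Fin K → Bool) :
    mask (flipX S T w x) (fun i => if u i then T i else S i) =
      shiftB (badSet S T) (mask x (fun i => if u i then T i else S i)) (w u) := by
  funext α
  simp only [mask, flipX, shiftB]
  split_ifs with h
  · rfl
  · congr 1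
    have hinj : ∀ v : Fin K → Bool, (fun i => (if u i then T i else S i) α) =
        (fun i => (if v i then T i else S i) α) → u = v := by
      intro v hv
      funext i
      have hi := congrFun hv i
      have hne : S i α ≠ T i α := fun hh => h (by simp [badSet]; exact ⟨i, hh⟩)
      cases hu : u i <;> cases hv' : v i <;> simp [hu, hv'] at hi ⊢
      · exact hne hi
      · exact hne hi.symm
    cases hw : w u α
    · simp only [decide_eq_false_iff_not]
      rintro ⟨v, hv, hv2⟩
      rw [← hinj v hv, hw] at hv2
      cases hv2
    · simp only [decide_eq_true_eq]
      exact ⟨u, rfl, hw⟩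

lemma inner_bound {K ℓ m d : ℕ} (μ f : (Fin m → Bool) → ℝ) (hμ : IsProbDist μ)
    (hf : ∀ z, f z = 1 ∨ f z = -1) (horth : Orthogonal μ d f)
    (S T : Fin K → Fin m → Fin ℓ) :
    ((2 : ℝ) ^ m) ^ (2 ^ K) * |𝔼 x : Fin m → (Fin K → Fin ℓ) → Bool, ∏ u : Fin K → Bool,
        (fun y => μ y * f y) (mask x (fun i => if u i then T i else S i))| ≤
      if (badSet S T).card < d then 0 else ((2 : ℝ) ^ (2 ^ K)) ^ (badSet S T).card := by
  set g : (Fin m → Bool) → ℝ := fun y => μ y * f y with hg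
  have e1 : ∀ w : (Fin K → Bool) → Fin m → Bool,
      𝔼 x : Fin m → (Fin K → Fin ℓ) → Bool, ∏ u : Fin K → Bool,
        g (mask x (fun i => if u i then T i else S i)) =
      𝔼 x : Fin m → (Fin K → Fin ℓ) → Bool, ∏ u : Fin K → Bool,
        g (shiftB (badSet S T) (mask x (fun i => if u i then T i else S i)) (w u)) := by
    intro w
    symm
    refine Fintype.expect_equiv (flipX_invol S T w).toPerm _ _ fun x => ?_
    refine Finset.prod_congr rfl fun u _ => ?_
    rw [← mask_flipX]
    rfl
  have e2 : ((2 : ℝ) ^ m) ^ (2 ^ K) * 𝔼 x : Fin m → (Fin K → Fin ℓ) → Bool,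
        ∏ u : Fin K → Bool, g (mask x (fun i => if u i then T i else S i)) =
      𝔼 x : Fin m → (Fin K → Fin ℓ) → Bool, ∏ u : Fin K → Bool, ∑ v,
        g (shiftB (badSet S T) (mask x (fun i => if u i then T i else S i)) v) := by
    have e3 : ∑ w : (Fin K → Bool) → Fin m → Bool,
        𝔼 x : Fin m → (Fin K → Fin ℓ) → Bool, ∏ u : Fin K → Bool,
        g (mask x (fun i => if u i then T i else S i)) = _ :=
      Finset.sum_congr rfl fun w _ => e1 w
    rw [Finset.sum_const, nsmul_eq_mul] at e3
    have hc : ((Finset.univ : Finset ((Fin K → Bool) → Fin m → Bool)).card : ℝ) =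
        ((2 : ℝ) ^ m) ^ (2 ^ K) := by
      simp
    rw [hc] at e3
    rw [e3, ← Finset.expect_sum_comm]
    refine Finset.expect_congr rfl fun x _ => ?_
    rw [Fintype.prod_sum]
  have e4 : ((2 : ℝ) ^ m) ^ (2 ^ K) * |𝔼 x : Fin m → (Fin K → Fin ℓ) → Bool,
        ∏ u : Fin K → Bool, g (mask x (fun i => if u i then T i else S i))| =
      |((2 : ℝ) ^ m) ^ (2 ^ K) * 𝔼 x : Fin m → (Fin K → Fin ℓ) → Bool,
        ∏ u : Fin K → Bool, g (mask x (fun i => if u i then T i else S i))| := by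
    rw [abs_mul, abs_of_nonneg (by positivity : (0:ℝ) ≤ ((2 : ℝ) ^ m) ^ (2 ^ K))]
  rw [e4, e2]
  split_ifs with hcard
  · rw [Finset.expect_eq_zero, abs_zero]
    intro x _
    refine Finset.prod_eq_zero (Finset.mem_univ (fun _ => false)) ?_
    exact sum_shiftB_zero μ f horth _ hcard _
  · refine (Finset.abs_expect_le _ _).trans (Finset.expect_le Finset.univ_nonempty fun x _ => ?_)
    rw [Finset.abs_prod]
    calc _ ≤ ∏ u : Fin K → Bool, (2 : ℝ) ^ (badSet S T).card :=
          Finset.prod_le_prod (fun _ _ => abs_nonneg _)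
            (fun u _ => sum_shiftB_le μ f hμ hf _ _)
      _ = _ := by
        simp [← pow_mul, mul_comm]

lemma pow_badSet_le {K ℓ m : ℕ} (C : ℝ) (hC : 1 ≤ C) (S T : Fin K → Fin m → Fin ℓ) :
    C ^ (badSet S T).card ≤ ∏ i, ∏ α, if S i α = T i α then C else 1 := by
  rw [Finset.prod_comm]
  have h1 : C ^ (badSet S T).card = ∏ α, if α ∈ badSet S T then C else 1 := by
    rw [Finset.prod_ite_mem, Finset.univ_inter, Finset.prod_const]
  rw [h1]
  have hge : ∀ i α, 1 ≤ if S i α = T i α then C else 1 := by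
    intro i α; split_ifs <;> simp [hC]
  refine Finset.prod_le_prod (fun α _ => by split_ifs <;> linarith) fun α _ => ?_
  split_ifs with h
  · obtain ⟨i, hi⟩ := (Finset.mem_filter.1 h).2
    rw [← Finset.mul_prod_erase _ _ (Finset.mem_univ i), if_pos hi]
    refine le_mul_of_one_le_right (by linarith) ?_
    calc (1 : ℝ) = ∏ j ∈ Finset.univ.erase i, 1 := by simp
      _ ≤ _ := Finset.prod_le_prod (fun _ _ => zero_le_one) (fun j _ => hge j α)
  · calc (1 : ℝ) = ∏ j : Fin K, 1 := by simp
      _ ≤ _ := Finset.prod_le_prod (fun _ _ => zero_le_one) (fun j _ => hge j α)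

lemma expect_badSet {K ℓ m : ℕ} (hℓ : 0 < ℓ) (C : ℝ) (hC : 1 ≤ C) :
    𝔼 S : Fin K → Fin m → Fin ℓ, 𝔼 T : Fin K → Fin m → Fin ℓ, C ^ (badSet S T).card ≤
      Real.exp (C * K * m / ℓ) := by
  have : Nonempty (Fin ℓ) := ⟨⟨0, hℓ⟩⟩
  have hℓ' : (0 : ℝ) < ℓ := by exact_mod_cast hℓ
  refine Finset.expect_le Finset.univ_nonempty fun S _ => ?_
  refine (Finset.expect_le_expect fun T _ => pow_badSet_le C hC S T).trans ?_
  rw [Fintype.expect_eq_sum_div_card]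
  have e1 : ∑ T : Fin K → Fin m → Fin ℓ, ∏ i, ∏ α, (if S i α = T i α then C else 1) =
      ((ℓ : ℝ) - 1 + C) ^ (m * K) := by
    rw [← Fintype.prod_sum (fun (i : Fin K) (t : Fin m → Fin ℓ) =>
      ∏ α, (if S i α = t α then C else 1))]
    have e2 : ∀ i, ∑ t : Fin m → Fin ℓ, ∏ α, (if S i α = t α then C else 1) =
        ((ℓ : ℝ) - 1 + C) ^ m := by
      intro i
      rw [← Fintype.prod_sum (fun (α : Fin m) (b : Fin ℓ) => (if S i α = b then C else 1))]
      have e3 : ∀ a : Fin ℓ, ∑ b : Fin ℓ, (if a = b then C else 1) = (ℓ : ℝ) - 1 + C := by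
        intro a
        have : ∀ b, (if a = b then C else 1) = (if a = b then (C - 1) else 0) + 1 := by
          intro b; split_ifs <;> ring
        simp only [this, Finset.sum_add_distrib]
        simp
        ring
      simp [e3]
    simp [e2, pow_mul]
  have e5 : (Fintype.card (Fin K → Fin m → Fin ℓ) : ℝ) = (ℓ : ℝ) ^ (m * K) := by
    simp [pow_mul]
  rw [e1, e5, ← div_pow]
  have h6 : ((ℓ : ℝ) - 1 + C) / ℓ ≤ Real.exp (C / ℓ) := by
    have := Real.add_one_le_exp (C / ℓ)
    refine le_trans ?_ this
    rw [div_le_iff₀ hℓ', add_mul, div_mul_cancel₀ _ hℓ'.ne']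
    linarith
  calc _ ≤ (Real.exp (C / ℓ)) ^ (m * K) :=
        pow_le_pow_left₀ (div_nonneg (by linarith) hℓ'.le) h6 _
    _ = _ := by
      rw [← Real.exp_nat_mul]
      congr 1
      push_cast
      ring

lemma expect_final {K ℓ m d : ℕ} (hK : 1 ≤ K) (hm : 1 ≤ m) (hd : 0 < d)
    (hℓ : (2 : ℝ) ^ (2 ^ (K + 1)) * K * Real.exp 1 * m / d ≤ (ℓ : ℝ) - 1) :
    𝔼 S : Fin K → Fin m → Fin ℓ, 𝔼 T : Fin K → Fin m → Fin ℓ,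
      (if (badSet S T).card < d then 0 else ((2 : ℝ) ^ (2 ^ K)) ^ (badSet S T).card) ≤
      (1 / 2) ^ d := by
  have hK' : (1 : ℝ) ≤ K := by exact_mod_cast hK
  have hm' : (1 : ℝ) ≤ m := by exact_mod_cast hm
  have hd' : (0 : ℝ) < d := by exact_mod_cast hd
  have hℓ1 : (0 : ℝ) < ℓ := by
    have : 0 ≤ (2 : ℝ) ^ (2 ^ (K + 1)) * K * Real.exp 1 * m / d := by positivity
    linarith
  have hℓ0 : 0 < ℓ := by exact_mod_cast hℓ1
  have : Nonempty (Fin ℓ) := ⟨⟨0, hℓ0⟩⟩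
  set c : ℝ := (2 : ℝ) ^ (2 ^ K) with hc
  have hc2 : (2 : ℝ) ^ (2 ^ (K + 1)) = c * c := by
    rw [hc, ← pow_add]; congr 1; ring
  have hcge : 2 ≤ c := by
    calc (2 : ℝ) = 2 ^ 1 := by norm_num
      _ ≤ c := pow_le_pow_right₀ (by norm_num) Nat.one_le_two_pow
  have hc0 : 0 < c := by linarith
  set t : ℝ := d * ℓ / (c * K * m) with ht
  have ht1 : c * Real.exp 1 ≤ t := by
    rw [ht, le_div_iff₀ (by positivity)]
    rw [hc2, div_le_iff₀ hd'] at hℓ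
    nlinarith
  have he : 1 ≤ Real.exp 1 := Real.one_le_exp (by norm_num)
  have ht2 : 2 * Real.exp 1 ≤ t := by nlinarith
  have ht3 : 1 ≤ t := by linarith
  have ht0 : 0 < t := by linarith
  have hterm : ∀ a : ℕ, (if a < d then 0 else c ^ a) ≤ (c * t) ^ a * (1 / t ^ d) := by
    intro a
    split_ifs with h
    · positivity
    · rw [mul_one_div, le_div_iff₀ (by positivity), mul_pow]
      exact mul_le_mul_of_nonneg_left (pow_le_pow_right₀ ht3 (not_lt.1 h)) (by positivity)
  calc _ ≤ 𝔼 S : Fin K → Fin m → Fin ℓ, 𝔼 T : Fin K → Fin m → Fin ℓ,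
        (c * t) ^ (badSet S T).card * (1 / t ^ d) :=
        Finset.expect_le_expect fun S _ => Finset.expect_le_expect fun T _ => hterm _
    _ = (𝔼 S : Fin K → Fin m → Fin ℓ, 𝔼 T : Fin K → Fin m → Fin ℓ,
        (c * t) ^ (badSet S T).card) * (1 / t ^ d) := by
        simp_rw [Finset.expect_mul]
    _ ≤ Real.exp (c * t * K * m / ℓ) * (1 / t ^ d) :=
        mul_le_mul_of_nonneg_right (expect_badSet hℓ0 _ (by nlinarith)) (by positivity)
    _ = (Real.exp 1 / t) ^ d := by
        have : c * t * K * m / ℓ = d * 1 := by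
          rw [ht]; field_simp
        rw [this, Real.exp_nat_mul, div_pow]
        ring
    _ ≤ (1 / 2) ^ d := by
        refine pow_le_pow_left₀ (by positivity) ?_ d
        rw [div_le_div_iff₀ ht0 (by norm_num)]
        linarith

lemma disc_core {K ℓ m d n : ℕ} (hK : 1 ≤ K) (hm : 1 ≤ m) (hd : 0 < d)
    (hℓ : (2 : ℝ) ^ (2 ^ (K + 1)) * K * Real.exp 1 * m / d ≤ (ℓ : ℝ) - 1)
    (hn : n = ℓ ^ K * m)
    (μ : (Fin m → Bool) → ℝ) (hμ : IsProbDist μ)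
    (f : (Fin m → Bool) → ℝ) (hf : ∀ z, f z = 1 ∨ f z = -1)
    (horth : Orthogonal μ d f)
    (φ : (Fin m → (Fin K → Fin ℓ) → Bool) × (Fin K → Fin m → Fin ℓ) → Bool)
    (hφ : IsCylinderIntersection φ) :
    (discPhi (fun p => μ (mask p.1 p.2) / ((ℓ : ℝ) ^ (m * K) * 2 ^ (n - m))) (Ffun f) φ) ^ (2 ^ K)
      ≤ (1 / 2) ^ d := by
  obtain ⟨ψ₀, ψ, h0, h1, h2⟩ := hφ
  have hℓ1 : (0 : ℝ) < ℓ := by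
    have : 0 ≤ (2 : ℝ) ^ (2 ^ (K + 1)) * K * Real.exp 1 * m / d := by positivity
    linarith
  have hℓ0 : 0 < ℓ := by exact_mod_cast hℓ1
  have : Nonempty (Fin ℓ) := ⟨⟨0, hℓ0⟩⟩
  set x0 : Fin m → (Fin K → Fin ℓ) → Bool := fun _ _ => false
  have hcs := cs_main (X := Fin m → (Fin K → Fin ℓ) → Bool) (V := Fin m → Fin ℓ) K
    (fun x S => (fun y => μ y * f y) (mask x S)) (fun S => bval (ψ₀ (x0, S)))
    (fun i x S => bval (ψ i (x, S)))
    (fun S => by cases ψ₀ (x0, S) <;> simp [bval])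
    (fun i x S => by cases ψ i (x, S) <;> simp [bval])
    (fun i x S S' h => by rw [h1 i x S S' h])
  have hbv : ∀ x S, bval (φ (x, S)) = bval (ψ₀ (x0, S)) * ∏ i, bval (ψ i (x, S)) := by
    intro x S
    rw [h2, h0 x x0]
    by_cases hall : ∀ i, ψ i (x, S) = true
    · simp [hall, bval]
    · have hz : ∏ i, bval (ψ i (x, S)) = 0 := by
        push Not at hall
        obtain ⟨i, hi⟩ := hall
        exact Finset.prod_eq_zero (Finset.mem_univ i) (by simp [bval, hi])
      rw [hz]
      simp [hall, bval]
  have hmn : m ≤ n := by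
    rw [hn]; exact Nat.le_mul_of_pos_left _ (by positivity)
  have hdisc : discPhi (fun p => μ (mask p.1 p.2) / ((ℓ : ℝ) ^ (m * K) * 2 ^ (n - m)))
      (Ffun f) φ = 2 ^ m * |𝔼 S : Fin K → Fin m → Fin ℓ, bval (ψ₀ (x0, S)) *
        𝔼 x : Fin m → (Fin K → Fin ℓ) → Bool, (fun y => μ y * f y) (mask x S) *
          ∏ i, bval (ψ i (x, S))| := by
    have h2m : |(2 : ℝ) ^ m| = 2 ^ m := abs_of_pos (by positivity)
    rw [discPhi, ← h2m, ← abs_mul]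
    congr 1
    rw [Fintype.sum_prod_type, Finset.sum_comm, Fintype.expect_eq_sum_div_card,
      ← mul_div_assoc, Finset.mul_sum, Finset.sum_div]
    refine Finset.sum_congr rfl fun S _ => ?_
    rw [Fintype.expect_eq_sum_div_card, ← mul_div_assoc, ← mul_div_assoc, div_div,
      Finset.mul_sum, Finset.mul_sum, Finset.sum_div]
    refine Finset.sum_congr rfl fun x _ => ?_
    rw [hbv]
    have hcX : (Fintype.card (Fin m → (Fin K → Fin ℓ) → Bool) : ℝ) = 2 ^ (n - m) * 2 ^ m := by
      rw [← pow_add, Nat.sub_add_cancel hmn, hn]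
      simp [pow_mul]
    have hcS : (Fintype.card (Fin K → Fin m → Fin ℓ) : ℝ) = (ℓ : ℝ) ^ (m * K) := by
      simp [pow_mul]
    rw [hcX, hcS]
    simp only [Ffun]
    field_simp
  rw [hdisc, mul_pow]
  refine (mul_le_mul_of_nonneg_left hcs (by positivity)).trans ?_
  refine le_trans ?_ (expect_final hK hm hd hℓ)
  rw [Finset.mul_expect]
  refine Finset.expect_le_expect fun S _ => ?_
  rw [Finset.mul_expect]
  exact Finset.expect_le_expect fun T _ => inner_bound μ f hμ hf horth S T

end helpers

/-- Orthogonality–Discrepancy Lemma, discrepancy bound: if `f` is `(μ,d)`-orthogonal,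
`d > 2`, and `ℓ - 1 ≥ 2^{2^k}(k-1)e·m/d`, then `disc_{k,λ}(F^f_k) ≤ 2^{-d/2^{k-1}}`. -/
theorem statement4 (k ℓ m d : ℕ) (hk : 2 ≤ k) (hm : 1 ≤ m) (hd : 2 < d)
    (hℓ : (2 : ℝ) ^ (2 ^ k) * (k - 1) * Real.exp 1 * m / d ≤ (ℓ : ℝ) - 1)
    (n : ℕ) (hn : n = ℓ ^ (k - 1) * m)
    (μ : (Fin m → Bool) → ℝ) (hμ : IsProbDist μ)
    (f : (Fin m → Bool) → ℝ) (hf : ∀ z, f z = 1 ∨ f z = -1)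
    (horth : Orthogonal μ d f) :
    disc (lamDist k ℓ m n μ) (Ffun f) ≤ (2 : ℝ) ^ (-(d : ℝ) / 2 ^ (k - 1)) := by
  refine Real.sSup_le ?_ (by positivity)
  rintro t ⟨φ, hφ, rfl⟩
  have h := disc_core (K := k - 1) (ℓ := ℓ) (m := m) (d := d) (n := n) (by omega) hm (by omega)
    (by
      rw [Nat.sub_add_cancel (by omega : 1 ≤ k), Nat.cast_sub (by omega : 1 ≤ k), Nat.cast_one]
      exact hℓ) hn μ hμ f hf horth φ hφ
  change (discPhi (lamDist k ℓ m n μ) (Ffun f) φ) ^ (2 ^ (k - 1)) ≤ _ at h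
  refine le_of_pow_le_pow_left₀ (n := 2 ^ (k - 1)) (by positivity) (by positivity) (h.trans ?_)
  rw [← Real.rpow_natCast _ (2 ^ (k - 1)), ← Real.rpow_mul (by norm_num)]
  push_cast
  rw [div_mul_cancel₀ _ (by positivity), Real.rpow_neg (by norm_num), Real.rpow_natCast]
  simp
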